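/- If Q is a directed subgraph of R (i.e., there is a directed graph monomorphism k: Q → R), then OA(Q) is completely isometrically isomorphic to the closed subalgebra of OA(R) generated by the image of Q under the canonical representation of R composed with k; in particular OA(Q) ⊆ OA(R). -/

import Mathlib

noncomputable section

open scoped Classical

/-! ## Operator algebras, concretely represented -/

/-- A (concrete) operator algebra: a norm-closed subalgebra of the bounded
operators on a complex Hilbert space. -/
structure OpAlg where
  H : Type
  [nacg : NormedAddCommGroup H]
  [ips : InnerProductSpace ℂ H]
  [cs : CompleteSpace H]
  carrier : NonUnitalSubalgebra ℂ (H →L[ℂ] H)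
  isClosed : IsClosed (carrier : Set (H →L[ℂ] H))

attribute [instance] OpAlg.nacg OpAlg.ips OpAlg.cs

/-- The amplification of an `n × n` matrix of operators on `H` to an operator on
`H ⊕₂ ⋯ ⊕₂ H` (`n` summands, with the Hilbert space norm). -/
def matAmp {H : Type} [NormedAddCommGroup H] [InnerProductSpace ℂ H]
    {n : ℕ} (a : Matrix (Fin n) (Fin n) (H →L[ℂ] H)) :
    (PiLp 2 fun _ : Fin n => H) →L[ℂ] (PiLp 2 fun _ : Fin n => H) :=
  ((PiLp.continuousLinearEquiv 2 ℂ fun _ : Fin n => H).symm.toContinuousLinearMap.comp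
    (ContinuousLinearMap.pi fun i => ∑ j, (a i j).comp (ContinuousLinearMap.proj j))).comp
    (PiLp.continuousLinearEquiv 2 ℂ fun _ : Fin n => H).toContinuousLinearMap

/-- The matrix norm of a matrix over a concrete operator algebra. -/
def matNorm (A : OpAlg) {n : ℕ} (a : Matrix (Fin n) (Fin n) A.carrier) : ℝ :=
  ‖matAmp fun i j => (a i j : A.H →L[ℂ] A.H)‖

/-- A completely contractive homomorphism of operator algebras. -/
structure CCHom (A B : OpAlg) where
  toHom : A.carrier →ₙₐ[ℂ] B.carrier
  completelyContractive : ∀ (n : ℕ) (a : Matrix (Fin n) (Fin n) A.carrier),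
    matNorm B (fun i j => toHom (a i j)) ≤ matNorm A a

/-- A completely isometric homomorphism. -/
def CCHom.CompletelyIsometric {A B : OpAlg} (φ : CCHom A B) : Prop :=
  ∀ (n : ℕ) (a : Matrix (Fin n) (Fin n) A.carrier),
    matNorm B (fun i j => φ.toHom (a i j)) = matNorm A a

/-- Two operator algebras are completely isometrically isomorphic if there is a
bijective completely isometric homomorphism between them. -/
def CIIso (A B : OpAlg) : Prop :=
  ∃ φ : CCHom A B, Function.Bijective φ.toHom ∧ φ.CompletelyIsometric

/-! ## Directed graphs -/

/-- A directed graph: vertices, edges, and source and range maps. -/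
structure DiGraph where
  V : Type
  E : Type
  s : E → V
  r : E → V

/-- A contractive representation of a directed graph in an operator algebra:
vertices go to (self-adjoint) projections, edges go to contractions, compatibly
with the range and source maps. -/
structure GraphRep (Q : DiGraph) (A : OpAlg) where
  v : Q.V → A.carrier
  e : Q.E → A.carrier
  idem : ∀ x, v x * v x = v x
  selfAdjoint : ∀ x, IsSelfAdjoint (v x : A.H →L[ℂ] A.H)
  contractive : ∀ x, ‖(e x : A.H →L[ℂ] A.H)‖ ≤ 1
  range_mul : ∀ x, v (Q.r x) * e x = e x
  mul_source : ∀ x, e x * v (Q.s x) = e x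

/-- The representation generates the operator algebra. -/
def GraphRep.Generates {Q : DiGraph} {A : OpAlg} (ρ : GraphRep Q A) : Prop :=
  closure ((NonUnitalAlgebra.adjoin ℂ (Set.range ρ.v ∪ Set.range ρ.e) :
    NonUnitalSubalgebra ℂ A.carrier) : Set A.carrier) = Set.univ

/-- A homomorphism extends (intertwines) two representations of the same graph. -/
def ExtendsRep {Q : DiGraph} {A B : OpAlg} (ψ : CCHom A B)
    (ρ : GraphRep Q A) (σ : GraphRep Q B) : Prop :=
  (∀ x, ψ.toHom (ρ.v x) = σ.v x) ∧ (∀ x, ψ.toHom (ρ.e x) = σ.e x)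

/-- `(A, ι)` is *the* universal operator algebra of the directed graph `Q`:
`ι` generates, and every contractive representation of `Q` factors uniquely
through a completely contractive homomorphism. -/
def IsUniversalOA (Q : DiGraph) (A : OpAlg) (ι : GraphRep Q A) : Prop :=
  ι.Generates ∧
    ∀ (B : OpAlg) (σ : GraphRep Q B), ∃! ψ : CCHom A B, ExtendsRep ψ ι σ


/-! ## Statement 4 specific definitions -/

/-- A homomorphism of directed graphs. -/
structure GraphHom (Q R : DiGraph) where
  vMap : Q.V → R.V
  eMap : Q.E → R.E
  s_eq : ∀ e, R.s (eMap e) = vMap (Q.s e)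
  r_eq : ∀ e, R.r (eMap e) = vMap (Q.r e)

/-- A monomorphism of directed graphs. -/
def GraphHom.Mono {Q R : DiGraph} (k : GraphHom Q R) : Prop :=
  Function.Injective k.vMap ∧ Function.Injective k.eMap

/-- Given a representation `ι` of `R` and a graph homomorphism `k : Q → R`, the closed
subalgebra generated by the image of `Q`, as an operator algebra on the same Hilbert
space. -/
def imageSubalgebra {Q R : DiGraph} (A : OpAlg) (ι : GraphRep R A)
    (k : GraphHom Q R) : OpAlg where
  H := A.H
  carrier := (NonUnitalAlgebra.adjoin ℂ
    (Set.range (fun x => (ι.v (k.vMap x) : A.H →L[ℂ] A.H)) ∪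
     Set.range (fun x => (ι.e (k.eMap x) : A.H →L[ℂ] A.H)))).topologicalClosure
  isClosed := NonUnitalSubalgebra.isClosed_topologicalClosure _

section Helpers

lemma matNorm_fin_one (A : OpAlg) (a : A.carrier) :
    matNorm A (n := 1) (fun _ _ => a) = ‖(a : A.H →L[ℂ] A.H)‖ := by
  have key : ∀ x : PiLp 2 fun _ : Fin 1 => A.H,
      ‖matAmp (n := 1) (fun _ _ => (a : A.H →L[ℂ] A.H)) x‖ = ‖(a : A.H →L[ℂ] A.H) (x 0)‖ := by
    intro x
    simp [PiLp.norm_eq_of_L2, matAmp]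
  have hx : ∀ x : PiLp 2 fun _ : Fin 1 => A.H, ‖x‖ = ‖x 0‖ := by
    intro x
    simp [PiLp.norm_eq_of_L2]
  apply le_antisymm
  · refine ContinuousLinearMap.opNorm_le_bound _ (norm_nonneg _) fun x => ?_
    rw [key, hx]
    exact ContinuousLinearMap.le_opNorm _ _
  · refine ContinuousLinearMap.opNorm_le_bound _ (norm_nonneg _) fun y => ?_
    have h := (matAmp (n := 1) (fun _ _ => (a : A.H →L[ℂ] A.H))).le_opNorm
      (WithLp.toLp 2 fun _ => y)
    rwa [key, hx] at h

lemma CCHom.norm_le {A B : OpAlg} (φ : CCHom A B) (a : A.carrier) : ‖φ.toHom a‖ ≤ ‖a‖ := by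
  have h := φ.completelyContractive 1 (fun _ _ => a)
  rwa [matNorm_fin_one, matNorm_fin_one] at h

lemma CCHom.continuous {A B : OpAlg} (φ : CCHom A B) : Continuous φ.toHom :=
  AddMonoidHomClass.continuous_of_bound φ.toHom 1 fun a => by simpa using φ.norm_le a

/-- A completely contractive homomorphism is determined by its values on a generating
representation. -/
lemma GraphRep.Generates.hom_ext {Q : DiGraph} {A B : OpAlg} {ρ : GraphRep Q A}
    (hρ : ρ.Generates) {σ : GraphRep Q B} {φ ψ : CCHom A B}
    (hφ : ExtendsRep φ ρ σ) (hψ : ExtendsRep ψ ρ σ) : φ = ψ := by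
  have hadj : ∀ a ∈ NonUnitalAlgebra.adjoin ℂ (Set.range ρ.v ∪ Set.range ρ.e),
      φ.toHom a = ψ.toHom a := by
    intro a ha
    induction ha using NonUnitalAlgebra.adjoin_induction with
    | mem x hx =>
      rcases hx with ⟨y, rfl⟩ | ⟨y, rfl⟩
      · rw [hφ.1, hψ.1]
      · rw [hφ.2, hψ.2]
    | add x y _ _ hx hy => rw [map_add, map_add, hx, hy]
    | zero => rw [map_zero, map_zero]
    | mul x y _ _ hx hy => rw [map_mul, map_mul, hx, hy]
    | smul c x _ hx => rw [map_smul, map_smul, hx]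
  have hfun : (φ.toHom : A.carrier → B.carrier) = ψ.toHom :=
    Continuous.ext_on (dense_iff_closure_eq.mpr hρ) φ.continuous ψ.continuous hadj
  cases φ
  cases ψ
  congr
  exact DFunLike.coe_injective hfun

/-- The extension by zero of a representation of `Q` along a monomorphism `Q → R`. -/
def GraphRep.extendByZero {Q R : DiGraph} {B : OpAlg} (σ : GraphRep Q B) (k : GraphHom Q R)
    (hk : k.Mono) : GraphRep R B where
  v := Function.extend k.vMap σ.v 0
  e := Function.extend k.eMap σ.e 0
  idem y := by
    by_cases h : ∃ x, k.vMap x = y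
    · obtain ⟨x, rfl⟩ := h
      rw [hk.1.extend_apply, σ.idem]
    · simp [Function.extend_apply' _ _ _ h]
  selfAdjoint y := by
    by_cases h : ∃ x, k.vMap x = y
    · obtain ⟨x, rfl⟩ := h
      rw [hk.1.extend_apply]
      exact σ.selfAdjoint x
    · simp [Function.extend_apply' _ _ _ h]
  contractive y := by
    by_cases h : ∃ x, k.eMap x = y
    · obtain ⟨x, rfl⟩ := h
      rw [hk.2.extend_apply]
      exact σ.contractive x
    · simp [Function.extend_apply' _ _ _ h]
  range_mul y := by
    by_cases h : ∃ x, k.eMap x = y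
    · obtain ⟨x, rfl⟩ := h
      rw [k.r_eq, hk.1.extend_apply, hk.2.extend_apply, σ.range_mul]
    · simp [Function.extend_apply' _ _ _ h]
  mul_source y := by
    by_cases h : ∃ x, k.eMap x = y
    · obtain ⟨x, rfl⟩ := h
      rw [k.s_eq, hk.1.extend_apply, hk.2.extend_apply, σ.mul_source]
    · simp [Function.extend_apply' _ _ _ h]

variable {Q R : DiGraph} (A : OpAlg) (ι : GraphRep R A) (k : GraphHom Q R)

lemma imageSubalgebra_carrier_le : (imageSubalgebra A ι k).carrier ≤ A.carrier := by
  have h : NonUnitalAlgebra.adjoin ℂ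
      (Set.range (fun x => (ι.v (k.vMap x) : A.H →L[ℂ] A.H)) ∪
       Set.range (fun x => (ι.e (k.eMap x) : A.H →L[ℂ] A.H))) ≤ A.carrier := by
    refine NonUnitalAlgebra.adjoin_le ?_
    rintro _ (⟨x, rfl⟩ | ⟨x, rfl⟩)
    · exact (ι.v (k.vMap x)).2
    · exact (ι.e (k.eMap x)).2
  exact NonUnitalSubalgebra.topologicalClosure_minimal h A.isClosed

lemma vertex_mem_imageSubalgebra (x : Q.V) :
    (ι.v (k.vMap x)).val ∈ (imageSubalgebra A ι k).carrier :=
  (NonUnitalAlgebra.adjoin ℂ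
    (Set.range (fun x => (ι.v (k.vMap x) : A.H →L[ℂ] A.H)) ∪
     Set.range (fun x => (ι.e (k.eMap x) : A.H →L[ℂ] A.H)))).le_topologicalClosure
    (NonUnitalAlgebra.subset_adjoin ℂ (Or.inl ⟨x, rfl⟩))

lemma edge_mem_imageSubalgebra (x : Q.E) :
    (ι.e (k.eMap x)).val ∈ (imageSubalgebra A ι k).carrier :=
  (NonUnitalAlgebra.adjoin ℂ
    (Set.range (fun x => (ι.v (k.vMap x) : A.H →L[ℂ] A.H)) ∪
     Set.range (fun x => (ι.e (k.eMap x) : A.H →L[ℂ] A.H)))).le_topologicalClosure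
    (NonUnitalAlgebra.subset_adjoin ℂ (Or.inr ⟨x, rfl⟩))

/-- The completely isometric inclusion of the image subalgebra. -/
def imageInclusion : CCHom (imageSubalgebra A ι k) A where
  toHom := NonUnitalSubalgebra.inclusion (imageSubalgebra_carrier_le A ι k)
  completelyContractive _ _ := le_rfl

/-- Composition of completely contractive homomorphisms. -/
def CCHom.comp {A B C : OpAlg} (ψ : CCHom B C) (φ : CCHom A B) : CCHom A C where
  toHom := ψ.toHom.comp φ.toHom
  completelyContractive n a :=
    (ψ.completelyContractive n fun i j => φ.toHom (a i j)).trans (φ.completelyContractive n a)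

/-- The restriction of a representation of `R` along `k : Q → R`, with values in the image
subalgebra. -/
def imageRep : GraphRep Q (imageSubalgebra A ι k) where
  v x := ⟨(ι.v (k.vMap x)).val, vertex_mem_imageSubalgebra A ι k x⟩
  e x := ⟨(ι.e (k.eMap x)).val, edge_mem_imageSubalgebra A ι k x⟩
  idem x := Subtype.ext <| by
    have h := congrArg Subtype.val (ι.idem (k.vMap x))
    exact h
  selfAdjoint x := ι.selfAdjoint (k.vMap x)
  contractive x := ι.contractive (k.eMap x)
  range_mul x := Subtype.ext <| by
    have h := congrArg Subtype.val (ι.range_mul (k.eMap x))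
    rwa [k.r_eq] at h
  mul_source x := Subtype.ext <| by
    have h := congrArg Subtype.val (ι.mul_source (k.eMap x))
    rwa [k.s_eq] at h

lemma imageRep_generates : (imageRep A ι k).Generates := by
  unfold GraphRep.Generates
  rw [Topology.IsInducing.subtypeVal.closure_eq_preimage_closure_image, Set.eq_univ_iff_forall]
  intro a
  have ha : a.val ∈ closure ((NonUnitalAlgebra.adjoin ℂ
      (Set.range (fun x => (ι.v (k.vMap x) : A.H →L[ℂ] A.H)) ∪
       Set.range (fun x => (ι.e (k.eMap x) : A.H →L[ℂ] A.H))) :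
       NonUnitalSubalgebra ℂ (A.H →L[ℂ] A.H)) : Set (A.H →L[ℂ] A.H)) := a.2
  refine closure_mono ?_ ha
  have hmap := NonUnitalAlgHom.map_adjoin ℂ _
    (NonUnitalSubalgebraClass.subtype (imageSubalgebra A ι k).carrier)
    (Set.range (imageRep A ι k).v ∪ Set.range (imageRep A ι k).e)
  rw [Set.image_union, ← Set.range_comp, ← Set.range_comp] at hmap
  exact (congrArg SetLike.coe hmap).ge

end Helpers

/-- If `Q` is a directed subgraph of `R` via a monomorphism `k`, then
`OA(Q)` is (completely isometrically isomorphic to) the closed subalgebra of `OA(R)`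
generated by the image of `Q` under the canonical representation of `R` composed
with `k`; in particular `OA(Q) ⊆ OA(R)`. -/
theorem universalOA_of_subgraph :
    ∀ (Q R : DiGraph) (k : GraphHom Q R), k.Mono →
    ∀ (A : OpAlg) (ιR : GraphRep R A), IsUniversalOA R A ιR →
      ∃ ιQ : GraphRep Q (imageSubalgebra A ιR k),
        (∀ x, (ιQ.v x).val = (ιR.v (k.vMap x) : A.H →L[ℂ] A.H)) ∧
        (∀ x, (ιQ.e x).val = (ιR.e (k.eMap x) : A.H →L[ℂ] A.H)) ∧
        IsUniversalOA Q (imageSubalgebra A ιR k) ιQ := by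
  intro Q R k hk A ιR hR
  refine ⟨imageRep A ιR k, fun _ => rfl, fun _ => rfl, imageRep_generates A ιR k, ?_⟩
  intro B σ
  obtain ⟨ψ, hψ, -⟩ := hR.2 B (σ.extendByZero k hk)
  have hext : ExtendsRep (ψ.comp (imageInclusion A ιR k)) (imageRep A ιR k) σ :=
    ⟨fun x => (hψ.1 (k.vMap x)).trans (hk.1.extend_apply _ _ x),
      fun x => (hψ.2 (k.eMap x)).trans (hk.2.extend_apply _ _ x)⟩
  exact ⟨_, hext, fun φ hφ => (imageRep_generates A ιR k).hom_ext hφ hext⟩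

end
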